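/- Let H be a complex Hilbert space and π : ℝ → B(H) a strongly continuous representation of ℝ on H by bounded invertible operators. Let β > 0, C > 0, N a natural number, v ∈ H, and suppose g : ℂ → H is holomorphic on the strip S_β with g(t) = π(t)v for all real t and ‖g(it)‖ ≤ C·(β − t)^{−N} for all t ∈ [0, β). Then for every w ∈ H such that the map t ↦ π(t)* w (the Hilbert-space adjoint of π(t) applied to w) is C^∞ from ℝ to H, the limit lim_{t → β⁻} ⟨g(it), w⟩ exists in ℂ. (In other words, the boundary value lim_{t→β} π^v(it) exists as a distribution vector: it exists weakly against all smooth vectors of the adjoint one-parameter group.) -/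

import Mathlib

open scoped InnerProductSpace

/-- A function whose derivative is dominated by that of a real function grows at most as fast. -/
lemma norm_le_add_sub_of_norm_deriv_le {E : Type*} [NormedAddCommGroup E] [NormedSpace ℝ E]
    {a b : ℝ} {f f' : ℝ → E} {B B' : ℝ → ℝ}
    (hf : ∀ x ∈ Set.Ico a b, HasDerivAt f (f' x) x)
    (hB : ∀ x ∈ Set.Ico a b, HasDerivAt B (B' x) x)
    (hbound : ∀ x ∈ Set.Ico a b, ‖f' x‖ ≤ B' x) {x : ℝ} (hx : x ∈ Set.Ico a b) :
    ‖f x‖ ≤ ‖f a‖ + (B x - B a) := by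
  have hsub : Set.Icc a x ⊆ Set.Ico a b := fun y hy => ⟨hy.1, hy.2.trans_lt hx.2⟩
  have hsub' : Set.Ico a x ⊆ Set.Ico a b := Set.Ico_subset_Icc_self.trans hsub
  have key := image_norm_le_of_norm_deriv_right_le_deriv_boundary'
    (f := f) (f' := f') (a := a) (b := x) (B := fun y => ‖f a‖ + (B y - B a)) (B' := B')
    (fun y hy => (hf y (hsub hy)).continuousAt.continuousWithinAt)
    (fun y hy => (hf y (hsub' hy)).hasDerivWithinAt) (by simp)
    (fun y hy => (((hB y (hsub hy)).sub_const _).const_add _).continuousAt.continuousWithinAt)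
    (fun y hy => (((hB y (hsub' hy)).sub_const _).const_add _).hasDerivWithinAt)
    (fun y hy => hbound y (hsub' hy))
  exact key ⟨hx.1, le_rfl⟩

/-- Integrating once improves a power-type bound at `β` by one order. -/
lemma exists_norm_le_rpow_add_one {E : Type*} [NormedAddCommGroup E] [NormedSpace ℝ E]
    {β p C D : ℝ} (hp : p ≠ -1) {f f' : ℝ → E}
    (hf : ∀ x ∈ Set.Ico 0 β, HasDerivAt f (f' x) x)
    (hbound : ∀ x ∈ Set.Ico 0 β, ‖f' x‖ ≤ C * (β - x) ^ p + D) :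
    ∃ C' D' : ℝ, ∀ x ∈ Set.Ico 0 β, ‖f x‖ ≤ C' * (β - x) ^ (p + 1) + D' := by
  have hp' : p + 1 ≠ 0 := fun h => hp (by linarith)
  let B : ℝ → ℝ := fun x => -C / (p + 1) * (β - x) ^ (p + 1) + D * x
  have hB : ∀ x ∈ Set.Ico 0 β, HasDerivAt B (C * (β - x) ^ p + D) x := by
    intro x hx
    have hx' : β - x ≠ 0 := (sub_pos.2 hx.2).ne'
    have h := ((((hasDerivAt_id x).const_sub β).rpow_const (p := p + 1)
      (Or.inl hx')).const_mul (-C / (p + 1))).add ((hasDerivAt_id x).const_mul D)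
    refine h.congr_deriv ?_
    simp only [id, add_sub_cancel_right]
    field_simp
  refine ⟨-C / (p + 1), ‖f 0‖ + |D| * β - B 0, fun x hx => ?_⟩
  have h := norm_le_add_sub_of_norm_deriv_le hf hB hbound hx
  have hD : D * x ≤ |D| * β :=
    mul_le_mul (le_abs_self D) hx.2.le hx.1 (abs_nonneg D)
  have hBx : B x = -C / (p + 1) * (β - x) ^ (p + 1) + D * x := rfl
  linarith

/-- A function with bounded derivative on `[a, b)` has a limit at `b`. -/
lemma exists_tendsto_of_norm_deriv_le {E : Type*} [NormedAddCommGroup E] [NormedSpace ℝ E]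
    [CompleteSpace E] {a b K : ℝ} (hab : a < b) {f f' : ℝ → E}
    (hf : ∀ x ∈ Set.Ico a b, HasDerivAt f (f' x) x)
    (hbound : ∀ x ∈ Set.Ico a b, ‖f' x‖ ≤ K) :
    ∃ L, Filter.Tendsto f (nhdsWithin b (Set.Iio b)) (nhds L) := by
  have hlip : LipschitzOnWith K.toNNReal f (Set.Ico a b) :=
    (convex_Ico a b).lipschitzOnWith_of_nnnorm_hasDerivWithin_le
      (fun x hx => (hf x hx).hasDerivWithinAt)
      (fun x hx => by
        rw [← NNReal.coe_le_coe, coe_nnnorm]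
        exact (hbound x hx).trans (Real.le_coe_toNNReal K))
  have hc : Cauchy (nhdsWithin b (Set.Iio b)) :=
    cauchy_nhds.mono nhdsWithin_le_nhds
  have := hc.map_of_le hlip.uniformContinuousOn
    (Filter.le_principal_iff.2 (Ico_mem_nhdsLT hab))
  exact CompleteSpace.complete this

/-- If all functions in a chain of successive derivatives blow up at most like a fixed power
at `β`, then they have limits at `β`. -/
lemma exists_tendsto_of_norm_deriv_chain_le {E : Type*} [NormedAddCommGroup E] [NormedSpace ℝ E]
    [CompleteSpace E] {β : ℝ} (hβ : 0 < β) (N : ℕ) {h : ℕ → ℝ → E}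
    (hderiv : ∀ k, ∀ x ∈ Set.Ico 0 β, HasDerivAt (h k) (h (k + 1) x) x)
    (hbound : ∀ k, ∃ C : ℝ, ∀ x ∈ Set.Ico 0 β, ‖h k x‖ ≤ C / (β - x) ^ N) (k : ℕ) :
    ∃ L, Filter.Tendsto (h k) (nhdsWithin β (Set.Iio β)) (nhds L) := by
  have hhalf : ∀ x ∈ Set.Ico 0 β, (β - x) ^ (1 / 2 : ℝ) ≤ β ^ (1 / 2 : ℝ) := fun x hx =>
    Real.rpow_le_rpow (sub_pos.2 hx.2).le (by linarith [hx.1]) (by norm_num)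
  -- half-integer exponents avoid the logarithmic case
  have improve : ∀ m : ℕ, ∀ k, ∃ C D : ℝ, ∀ x ∈ Set.Ico 0 β,
      ‖h k x‖ ≤ C * (β - x) ^ ((m : ℝ) - N - 1 / 2) + D := by
    intro m
    induction m with
    | zero =>
      intro k
      obtain ⟨C, hC⟩ := hbound k
      refine ⟨|C| * β ^ (1 / 2 : ℝ), 0, fun x hx => (hC x hx).trans ?_⟩
      have hpos : 0 < β - x := sub_pos.2 hx.2
      have hsplit : ((β - x) ^ N)⁻¹ =
          (β - x) ^ (1 / 2 : ℝ) * (β - x) ^ (((0 : ℕ) : ℝ) - N - 1 / 2) := by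
        rw [← Real.rpow_add hpos, ← Real.rpow_natCast, ← Real.rpow_neg hpos.le]
        congr 1
        push_cast
        ring
      rw [div_eq_mul_inv, hsplit, add_zero, mul_assoc]
      have h1 := hhalf x hx
      gcongr
      exact le_abs_self C
    | succ m ih =>
      intro k
      obtain ⟨C, D, hCD⟩ := ih (k + 1)
      have hp : (m : ℝ) - N - 1 / 2 ≠ -1 := by
        intro heq
        have : ((2 * m + 1 : ℕ) : ℝ) = ((2 * N : ℕ) : ℝ) := by push_cast; linarith
        have := Nat.cast_injective this
        omega
      obtain ⟨C', D', h'⟩ := exists_norm_le_rpow_add_one hp (hderiv k) hCD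
      refine ⟨C', D', fun x hx => (h' x hx).trans_eq ?_⟩
      congr 3
      push_cast
      ring
  obtain ⟨C, D, hCD⟩ := improve (N + 1) (k + 1)
  refine exists_tendsto_of_norm_deriv_le (K := |C| * β ^ (1 / 2 : ℝ) + D) hβ (hderiv k)
    fun x hx => (hCD x hx).trans ?_
  have hexp : ((N + 1 : ℕ) : ℝ) - N - 1 / 2 = 1 / 2 := by push_cast; ring
  rw [hexp]
  have h1 := hhalf x hx
  have hpos : 0 < β - x := sub_pos.2 hx.2
  gcongr
  exact le_abs_self C

lemma isOpen_strip (β : ℝ) : IsOpen {z : ℂ | |z.im| < β} :=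
  isOpen_lt (by fun_prop) continuous_const

lemma convex_strip (β : ℝ) : Convex ℝ {z : ℂ | |z.im| < β} := by
  have h : {z : ℂ | |z.im| < β} = Complex.imLm ⁻¹' Set.Ioo (-β) β := by
    ext z
    simp [abs_lt]
  rw [h]
  exact (convex_Ioo _ _).linear_preimage _

lemma hasDerivAt_iteratedDeriv_of_strip {β : ℝ} {F : ℂ → ℂ}
    (hF : DifferentiableOn ℂ F {z : ℂ | |z.im| < β}) (k : ℕ) {z : ℂ} (hz : |z.im| < β) :
    HasDerivAt (iteratedDeriv k F) (iteratedDeriv (k + 1) F z) z := by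
  rw [iteratedDeriv_succ, iteratedDeriv_eq_iterate]
  exact ((hF.analyticOnNhd (isOpen_strip β)).iterated_deriv k z hz).differentiableAt.hasDerivAt

/-- A holomorphic extension of an orbit map to a strip is equivariant for real translations. -/
lemma map_add_eq_of_orbit_extension {H : Type*} [NormedAddCommGroup H] [NormedSpace ℂ H]
    [CompleteSpace H] {π : ℝ → H →L[ℂ] H} (hπadd : ∀ s t : ℝ, π (s + t) = π s ∘L π t)
    {β : ℝ} {v : H} {g : ℂ → H}
    (hg : DifferentiableOn ℂ g {z : ℂ | |z.im| < β}) (hgv : ∀ t : ℝ, g t = π t v)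
    (s : ℝ) {z : ℂ} (hz : |z.im| < β) : g (s + z) = π s (g z) := by
  have hβ : 0 < β := (abs_nonneg _).trans_lt hz
  have hleft : DifferentiableOn ℂ (fun z : ℂ => g (s + z)) {z : ℂ | |z.im| < β} :=
    hg.comp (by fun_prop) fun z hz => by simpa using hz
  have hright : DifferentiableOn ℂ (fun z : ℂ => π s (g z)) {z : ℂ | |z.im| < β} :=
    (π s).differentiable.comp_differentiableOn hg
  have hreal : ∃ᶠ z in nhdsWithin (0 : ℂ) {0}ᶜ, g (s + z) = π s (g z) := by
    have ht : Filter.Tendsto (fun t : ℝ => (t : ℂ)) (nhdsWithin 0 {0}ᶜ)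
        (nhdsWithin (0 : ℂ) {0}ᶜ) := by
      refine tendsto_nhdsWithin_of_tendsto_nhds_of_eventually_within _ ?_ ?_
      · exact (Complex.continuous_ofReal.tendsto' 0 0 Complex.ofReal_zero).mono_left
          nhdsWithin_le_nhds
      · filter_upwards [self_mem_nhdsWithin] with t ht
        simpa using ht
    refine ht.frequently (Filter.Frequently.of_forall fun t => ?_)
    rw [← Complex.ofReal_add, hgv, hgv, hπadd]
    rfl
  exact (hleft.analyticOnNhd (isOpen_strip β)).eqOn_of_preconnected_of_frequently_eq
    (hright.analyticOnNhd (isOpen_strip β)) (convex_strip β).isPreconnected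
    (by simpa using hβ) hreal hz

/-- Complex derivatives of a holomorphic function are computed along horizontal lines: if
`F (s + z) = ⟪φ s, x⟫` for real `s`, the same holds for the iterated derivatives. -/
lemma iteratedDeriv_add_eq_inner {H : Type*} [NormedAddCommGroup H] [InnerProductSpace ℂ H]
    {β : ℝ} {F : ℂ → ℂ} (hF : DifferentiableOn ℂ F {z : ℂ | |z.im| < β})
    {φ : ℝ → H} (hφ : ContDiff ℝ (⊤ : ℕ∞) φ) {x : H} {z : ℂ} (hz : |z.im| < β)
    (h : ∀ s : ℝ, F (s + z) = ⟪φ s, x⟫_ℂ) (k : ℕ) (s : ℝ) :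
    iteratedDeriv k F (s + z) = ⟪iteratedDeriv k φ s, x⟫_ℂ := by
  induction k generalizing s with
  | zero => simpa using h s
  | succ k ih =>
    have h1 : HasDerivAt (fun t : ℝ => iteratedDeriv k F (t + z))
        (iteratedDeriv (k + 1) F (s + z)) s :=
      (HasDerivAt.comp_add_const (s : ℂ) z
        (hasDerivAt_iteratedDeriv_of_strip hF k (by simpa using hz))).comp_ofReal
    have h2 : HasDerivAt (fun t : ℝ => ⟪iteratedDeriv k φ t, x⟫_ℂ)
        ⟪iteratedDeriv (k + 1) φ s, x⟫_ℂ s := by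
      have hd : DifferentiableAt ℝ (iteratedDeriv k φ) s :=
        hφ.differentiable_iteratedDeriv k (by exact_mod_cast WithTop.coe_lt_top k) s
      rw [iteratedDeriv_succ]
      simpa using hd.hasDerivAt.inner ℂ (hasDerivAt_const s x)
    simp only [ih] at h1
    exact h1.unique h2

/-- If the orbit map of `v` under a strongly continuous representation of `ℝ`
on a Hilbert space extends holomorphically to the strip `S_β` with slow growth
`‖g(it)‖ ≤ C (β - t)⁻ᴺ` on `[0, β)`, then the boundary value `lim_{t→β⁻} g(it)`
exists weakly against every smooth vector `w` of the adjoint one-parameter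
group. -/
theorem distributional_boundary_limit
    {H : Type*} [NormedAddCommGroup H] [InnerProductSpace ℂ H] [CompleteSpace H]
    (π : ℝ → H →L[ℂ] H)
    (hπ0 : π 0 = 1)
    (hπadd : ∀ s t : ℝ, π (s + t) = π s ∘L π t)
    (hπinv : ∀ t : ℝ, IsUnit (π t))
    (hπcont : ∀ w : H, Continuous fun t : ℝ => π t w)
    (β C : ℝ) (hβ : 0 < β) (hC : 0 < C) (N : ℕ) (v : H) (g : ℂ → H)
    (hg : DifferentiableOn ℂ g {z : ℂ | |z.im| < β})
    (hgv : ∀ t : ℝ, g t = π t v)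
    (hbound : ∀ t ∈ Set.Ico (0 : ℝ) β,
      ‖g (t * Complex.I)‖ ≤ C / (β - t) ^ N) :
    ∀ w : H,
      (ContDiff ℝ (⊤ : ℕ∞) fun t : ℝ => ContinuousLinearMap.adjoint (π t) w) →
      ∃ L : ℂ, Filter.Tendsto (fun t : ℝ => ⟪g (t * Complex.I), w⟫_ℂ)
        (nhdsWithin β (Set.Iio β)) (nhds L) := by
  intro w hw
  set φ : ℝ → H := fun t => ContinuousLinearMap.adjoint (π t) w with hφ
  set F : ℂ → ℂ := fun z => ⟪w, g z⟫_ℂ with hFdef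
  have hF : DifferentiableOn ℂ F {z : ℂ | |z.im| < β} :=
    (innerSL ℂ w).differentiable.comp_differentiableOn hg
  have hstrip : ∀ t ∈ Set.Ico 0 β, |((t : ℂ) * Complex.I).im| < β := fun t ht => by
    simpa [abs_of_nonneg ht.1] using ht.2
  have hFφ : ∀ t ∈ Set.Ico 0 β, ∀ s : ℝ,
      F (s + t * Complex.I) = ⟪φ s, g (t * Complex.I)⟫_ℂ := fun t ht s => by
    simp only [hFdef, hφ, map_add_eq_of_orbit_extension hπadd hg hgv s (hstrip t ht),
      ContinuousLinearMap.adjoint_inner_left]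
  have hderiv : ∀ k : ℕ, ∀ t ∈ Set.Ico 0 β,
      HasDerivAt (fun t : ℝ => Complex.I ^ k * iteratedDeriv k F (t * Complex.I))
        (Complex.I ^ (k + 1) * iteratedDeriv (k + 1) F (t * Complex.I)) t := by
    intro k t ht
    have hd := hasDerivAt_iteratedDeriv_of_strip hF k (hstrip t ht)
    have hline : HasDerivAt (fun z : ℂ => z * Complex.I) Complex.I (t : ℂ) := by
      simpa using (hasDerivAt_id (t : ℂ)).mul_const Complex.I
    refine ((hd.comp (t : ℂ) hline).comp_ofReal.const_mul (Complex.I ^ k)).congr_deriv ?_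
    ring
  have hgrowth : ∀ k : ℕ, ∃ K : ℝ, ∀ t ∈ Set.Ico 0 β,
      ‖Complex.I ^ k * iteratedDeriv k F (t * Complex.I)‖ ≤ K / (β - t) ^ N := by
    refine fun k => ⟨‖iteratedDeriv k φ 0‖ * C, fun t ht => ?_⟩
    have h := iteratedDeriv_add_eq_inner hF hw (hstrip t ht) (hFφ t ht) k 0
    rw [Complex.ofReal_zero, zero_add] at h
    rw [norm_mul, norm_pow, Complex.norm_I, one_pow, one_mul, h, mul_div_assoc]
    exact (norm_inner_le_norm _ _).trans
      (mul_le_mul_of_nonneg_left (hbound t ht) (norm_nonneg _))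
  obtain ⟨L, hL⟩ := exists_tendsto_of_norm_deriv_chain_le hβ N hderiv hgrowth 0
  refine ⟨starRingEnd ℂ L, ((Complex.continuous_conj.tendsto L).comp hL).congr fun t => ?_⟩
  simp [hFdef, inner_conj_symm]
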